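/- arXiv:0801.0650 — 2 statements merged into one kernel-verified Lean document; each statement's English description precedes it below -/
import Mathlib

section
/- Let n, m ≥ 1 and let B_1, ..., B_m be n×n real symmetric matrices. Then Σ_{r,s=1}^m ‖[B_r, B_s]‖² ≤ (Σ_{r=1}^m ‖B_r‖²)². -/
open Matrix BigOperators

/-- The squared Frobenius norm: sum of squares of the entries. -/
noncomputable def frobSq {n : ℕ} (A : Matrix (Fin n) (Fin n) ℝ) : ℝ :=
  ∑ i, ∑ j, (A i j) ^ 2

/-- The commutator of two matrices. -/
def mcomm {n : ℕ} (A B : Matrix (Fin n) (Fin n) ℝ) : Matrix (Fin n) (Fin n) ℝ :=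
  A * B - B * A


lemma dd_star {n : ℕ} (l : Fin n → ℝ) (hl : ∑ i, l i ^ 2 = 1) (p : Fin n)
    (S : Finset (Fin n)) (hp : p ∉ S) :
    ∑ j ∈ S, ((l p - l j) ^ 2 - 1) ≤ 1 := by
  have h1 : l p ^ 2 + ∑ j ∈ S, l j ^ 2 ≤ 1 := by
    rw [← hl, ← Finset.sum_insert (f := fun j => l j ^ 2) hp]
    exact Finset.sum_le_sum_of_subset_of_nonneg (Finset.subset_univ _)
      (fun i _ _ => sq_nonneg _)
  have h2 : (∑ j ∈ S, l j) ^ 2 ≤ (S.card : ℝ) * ∑ j ∈ S, l j ^ 2 :=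
    sq_sum_le_card_mul_sum_sq
  have h3 : ∑ j ∈ S, ((l p - l j) ^ 2 - 1)
      = S.card * (l p ^ 2 - 1) - 2 * l p * (∑ j ∈ S, l j) + ∑ j ∈ S, l j ^ 2 := by
    rw [Finset.mul_sum, ← nsmul_eq_mul, ← Finset.sum_const, ← Finset.sum_sub_distrib,
      ← Finset.sum_add_distrib]
    exact Finset.sum_congr rfl fun j _ => by ring
  rw [h3]
  have h4 : (0 : ℝ) ≤ S.card := Nat.cast_nonneg _
  nlinarith [sq_nonneg (l p + ∑ j ∈ S, l j), mul_le_mul_of_nonneg_left h1 h4]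

lemma dd_triangle {n : ℕ} (l : Fin n → ℝ) (hl : ∑ i, l i ^ 2 = 1) (p q r : Fin n)
    (h1 : 1 < (l p - l q) ^ 2) (h2 : 1 < (l q - l r) ^ 2) (h3 : 1 < (l p - l r) ^ 2) : False := by
  have hpq : p ≠ q := by rintro rfl; norm_num at h1
  have hqr : q ≠ r := by rintro rfl; norm_num at h2
  have hpr : p ≠ r := by rintro rfl; norm_num at h3
  have h : ∑ i ∈ {p, q, r}, l i ^ 2 ≤ 1 := by
    rw [← hl]
    exact Finset.sum_le_sum_of_subset_of_nonneg (Finset.subset_univ _)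
      (fun i _ _ => sq_nonneg _)
  rw [Finset.sum_insert (by simp [*]), Finset.sum_pair hqr] at h
  nlinarith [sq_nonneg (l p + l q + l r)]

lemma dd_disjoint {n : ℕ} (l : Fin n → ℝ) (hl : ∑ i, l i ^ 2 = 1) (p q r s : Fin n)
    (h1 : 1 < (l p - l q) ^ 2) (h2 : 1 < (l r - l s) ^ 2)
    (hpr : p ≠ r) (hps : p ≠ s) (hqr : q ≠ r) (hqs : q ≠ s) : False := by
  have hpq : p ≠ q := by rintro rfl; norm_num at h1
  have hrs : r ≠ s := by rintro rfl; norm_num at h2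
  have h : ∑ i ∈ {p, q, r, s}, l i ^ 2 ≤ 1 := by
    rw [← hl]
    exact Finset.sum_le_sum_of_subset_of_nonneg (Finset.subset_univ _)
      (fun i _ _ => sq_nonneg _)
  rw [Finset.sum_insert (by simp [*]), Finset.sum_insert (by simp [*]), Finset.sum_pair hrs] at h
  nlinarith [sq_nonneg (l p + l q), sq_nonneg (l r + l s)]

lemma dd_center {n : ℕ} (l : Fin n → ℝ) (hl : ∑ i, l i ^ 2 = 1) (p₀ : Fin n) :
    ∃ p, ∀ i j, 1 < (l i - l j) ^ 2 → i = p ∨ j = p := by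
  by_contra! hcon
  obtain ⟨p, q, h1, -, -⟩ := hcon p₀
  have sym : ∀ i j, 1 < (l i - l j) ^ 2 → 1 < (l j - l i) ^ 2 := by
    intro i j h; nlinarith
  have key : ∀ a b c d, 1 < (l a - l b) ^ 2 → 1 < (l c - l d) ^ 2 →
      a = c ∨ a = d ∨ b = c ∨ b = d := by
    intro a b c d h h'
    by_contra! hh
    exact dd_disjoint l hl a b c d h h' hh.1 hh.2.1 hh.2.2.1 hh.2.2.2
  have ex : ∀ x y, 1 < (l x - l y) ^ 2 → ∃ r, r ≠ x ∧ 1 < (l y - l r) ^ 2 := by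
    intro x y hxy
    obtain ⟨c, d, h, hc, hd⟩ := hcon x
    rcases key x y c d hxy h with e | e | e | e
    · exact absurd e.symm hc
    · exact absurd e.symm hd
    · subst e; exact ⟨d, hd, h⟩
    · subst e; exact ⟨c, hc, sym _ _ h⟩
  obtain ⟨r, hr, h2⟩ := ex p q h1
  obtain ⟨t, ht, h3⟩ := ex q p (sym _ _ h1)
  rcases key q r p t h2 h3 with e | e | e | e
  · subst e; norm_num at h1
  · exact ht e.symm
  · exact hr e
  · subst e
    exact dd_triangle l hl p q r h1 h2 h3

lemma dd_two {n : ℕ} (l : Fin n → ℝ) (hl : ∑ i, l i ^ 2 = 1) :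
    ∑ i, ∑ j, max ((l i - l j) ^ 2 - 1) 0 ≤ 2 := by
  rcases isEmpty_or_nonempty (Fin n) with he | ⟨⟨p₀⟩⟩
  · simp
  obtain ⟨p, hp⟩ := dd_center l hl p₀
  have hstar : ∑ j, max ((l p - l j) ^ 2 - 1) 0 ≤ 1 := by
    refine le_trans (le_of_eq ?_)
      (dd_star l hl p (Finset.univ.filter fun j => 1 < (l p - l j) ^ 2) (by simp))
    rw [Finset.sum_filter]
    refine Finset.sum_congr rfl fun j _ => ?_
    split_ifs with h
    · exact max_eq_left (by linarith)
    · exact max_eq_right (by linarith)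
  have hle : ∀ i j, max ((l i - l j) ^ 2 - 1) 0 ≤
      (if i = p then max ((l p - l j) ^ 2 - 1) 0 else 0)
      + (if j = p then max ((l p - l i) ^ 2 - 1) 0 else 0) := by
    intro i j
    have n1 : 0 ≤ (if i = p then max ((l p - l j) ^ 2 - 1) 0 else 0) := by
      split_ifs
      · exact le_max_right _ _
      · exact le_rfl
    have n2 : 0 ≤ (if j = p then max ((l p - l i) ^ 2 - 1) 0 else 0) := by
      split_ifs
      · exact le_max_right _ _
      · exact le_rfl
    by_cases h : 1 < (l i - l j) ^ 2
    · rcases hp i j h with e | e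
      · subst e; simp only [if_true] at *; linarith
      · subst e
        rw [show (l i - l j) ^ 2 = (l j - l i) ^ 2 by ring]
        simp only [if_true] at *; linarith
    · rw [max_eq_right (by linarith)]; linarith
  calc _ ≤ ∑ i, ∑ j, ((if i = p then max ((l p - l j) ^ 2 - 1) 0 else 0)
      + (if j = p then max ((l p - l i) ^ 2 - 1) 0 else 0)) :=
        Finset.sum_le_sum fun i _ => Finset.sum_le_sum fun j _ => hle i j
    _ = ∑ j, max ((l p - l j) ^ 2 - 1) 0 + ∑ j, max ((l p - l j) ^ 2 - 1) 0 := by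
        simp only [Finset.sum_add_distrib]
        congr 1
        · rw [Finset.sum_comm]; simp
        · simp
    _ ≤ 2 := by linarith

/-- The Frobenius inner product. -/
noncomputable def fip {n : ℕ} (A B : Matrix (Fin n) (Fin n) ℝ) : ℝ := (Aᵀ * B).trace

lemma fip_eq {n : ℕ} (A B : Matrix (Fin n) (Fin n) ℝ) : fip A B = ∑ i, ∑ j, A i j * B i j := by
  simp only [fip, Matrix.trace, Matrix.diag, Matrix.mul_apply, Matrix.transpose_apply]
  exact Finset.sum_comm

lemma frobSq_eq {n : ℕ} (A : Matrix (Fin n) (Fin n) ℝ) : frobSq A = fip A A := by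
  rw [fip_eq]; simp only [frobSq, sq]

lemma frobSq_nonneg {n : ℕ} (A : Matrix (Fin n) (Fin n) ℝ) : 0 ≤ frobSq A :=
  Finset.sum_nonneg fun _ _ => Finset.sum_nonneg fun _ _ => sq_nonneg _

lemma frobSq_smul {n : ℕ} (c : ℝ) (A : Matrix (Fin n) (Fin n) ℝ) :
    frobSq (c • A) = c ^ 2 * frobSq A := by
  simp only [frobSq, Matrix.smul_apply, smul_eq_mul, mul_pow, Finset.mul_sum]

lemma fip_smul {n : ℕ} (c d : ℝ) (A B : Matrix (Fin n) (Fin n) ℝ) :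
    fip (c • A) (d • B) = c * d * fip A B := by
  simp [fip]; ring

lemma frobSq_zero_iff {n : ℕ} (A : Matrix (Fin n) (Fin n) ℝ) (h : frobSq A = 0) : A = 0 := by
  ext i j
  have h1 := (Finset.sum_eq_zero_iff_of_nonneg
    (fun i _ => Finset.sum_nonneg fun j _ => sq_nonneg (A i j))).1 h i (Finset.mem_univ _)
  have h2 := (Finset.sum_eq_zero_iff_of_nonneg
    (fun j _ => sq_nonneg (A i j))).1 h1 j (Finset.mem_univ _)
  simpa using h2

lemma dd_bessel {n : ℕ} {ι : Type*} [DecidableEq ι] (S : Finset ι)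
    (X : ι → Matrix (Fin n) (Fin n) ℝ)
    (hX : ∀ s ∈ S, (X s).IsSymm)
    (ho : ∀ s ∈ S, ∀ t ∈ S, fip (X s) (X t) = if s = t then 1 else 0)
    (i j : Fin n) (hij : i ≠ j) : ∑ s ∈ S, X s i j ^ 2 ≤ 1 / 2 := by
  set T := ∑ s ∈ S, X s i j ^ 2 with hT
  set Y : Matrix (Fin n) (Fin n) ℝ := ∑ s ∈ S, X s i j • X s with hY
  have h1 : frobSq Y = T := by
    rw [frobSq_eq, hY]
    simp only [fip, Matrix.transpose_sum, Matrix.sum_mul, Matrix.mul_sum, Matrix.trace_sum]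
    rw [hT, Finset.sum_comm]
    refine Finset.sum_congr rfl fun s hs => ?_
    have : ∀ t ∈ S, ((X s i j • X s)ᵀ * (X t i j • X t)).trace
        = if s = t then X s i j * X t i j else 0 := by
      intro t ht
      have := fip_smul (X s i j) (X t i j) (X s) (X t)
      rw [ho s hs t ht] at this
      rw [fip] at this
      rw [this]; split_ifs <;> simp
    rw [Finset.sum_congr rfl this, Finset.sum_ite_eq, if_pos hs, sq]
  have h2 : Y i j = T := by
    simp [hY, hT, Matrix.sum_apply, sq]
  have h3 : Y j i = T := by
    simp only [hY, hT, Matrix.sum_apply, Matrix.smul_apply, smul_eq_mul, sq]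
    exact Finset.sum_congr rfl fun s hs => by rw [(hX s hs).apply i j]
  have h4 : Y i j ^ 2 + Y j i ^ 2 ≤ frobSq Y := by
    unfold frobSq
    have e1 : ∀ a b, Y a b ^ 2 ≤ ∑ c, Y a c ^ 2 := fun a b =>
      Finset.single_le_sum (f := fun c => Y a c ^ 2) (fun _ _ => sq_nonneg _) (Finset.mem_univ b)
    have e2 : ∑ a ∈ {i, j}, ∑ c, Y a c ^ 2 ≤ ∑ a, ∑ c, Y a c ^ 2 :=
      Finset.sum_le_sum_of_subset_of_nonneg (Finset.subset_univ _)
        (fun _ _ _ => Finset.sum_nonneg fun _ _ => sq_nonneg _)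
    rw [Finset.sum_pair hij] at e2
    linarith [e1 i j, e1 j i]
  rw [h1, h2, h3] at h4
  by_contra! hlt
  nlinarith

lemma dd_diag {n : ℕ} {ι : Type*} [DecidableEq ι] (S : Finset ι)
    (X : ι → Matrix (Fin n) (Fin n) ℝ)
    (hX : ∀ s ∈ S, (X s).IsSymm)
    (ho : ∀ s ∈ S, ∀ t ∈ S, fip (X s) (X t) = if s = t then 1 else 0)
    (l : Fin n → ℝ) (hl : ∑ i, l i ^ 2 = 1) :
    ∑ s ∈ S, (frobSq (mcomm (Matrix.diagonal l) (X s)) - 1) ≤ 1 := by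
  have h1 : ∀ s ∈ S, frobSq (mcomm (Matrix.diagonal l) (X s)) - 1
      ≤ ∑ i, ∑ j, max ((l i - l j) ^ 2 - 1) 0 * X s i j ^ 2 := by
    intro s hs
    have h := ho s hs s hs
    rw [if_pos rfl, ← frobSq_eq] at h
    nth_rewrite 1 [← h]
    simp only [frobSq, ← Finset.sum_sub_distrib]
    refine Finset.sum_le_sum fun i _ => Finset.sum_le_sum fun j _ => ?_
    simp only [mcomm, Matrix.sub_apply, Matrix.diagonal_mul, Matrix.mul_diagonal]
    calc _ = ((l i - l j) ^ 2 - 1) * X s i j ^ 2 := by ring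
      _ ≤ _ := mul_le_mul_of_nonneg_right (le_max_left _ _) (sq_nonneg _)
  calc _ ≤ ∑ s ∈ S, ∑ i, ∑ j, max ((l i - l j) ^ 2 - 1) 0 * X s i j ^ 2 := Finset.sum_le_sum h1
    _ = ∑ i, ∑ j, max ((l i - l j) ^ 2 - 1) 0 * ∑ s ∈ S, X s i j ^ 2 := by
      rw [Finset.sum_comm]
      refine Finset.sum_congr rfl fun i _ => ?_
      rw [Finset.sum_comm]
      simp only [Finset.mul_sum]
    _ ≤ ∑ i, ∑ j, max ((l i - l j) ^ 2 - 1) 0 * (1 / 2) := by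
      refine Finset.sum_le_sum fun i _ => Finset.sum_le_sum fun j _ => ?_
      by_cases hij : i = j
      · subst hij; simp
      · exact mul_le_mul_of_nonneg_left (dd_bessel S X hX ho i j hij) (le_max_right _ _)
    _ ≤ 1 := by
      simp only [← Finset.sum_mul]
      linarith [dd_two l hl]

lemma fip_conj {n : ℕ} (U A B : Matrix (Fin n) (Fin n) ℝ) (hU : U * Uᵀ = 1) :
    fip (Uᵀ * A * U) (Uᵀ * B * U) = fip A B := by
  simp only [fip, Matrix.transpose_mul, Matrix.transpose_transpose]
  calc (Uᵀ * (Aᵀ * U) * (Uᵀ * B * U)).trace = (Uᵀ * (Aᵀ * (U * Uᵀ) * B * U)).trace := by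
        simp only [Matrix.mul_assoc]
    _ = (Aᵀ * B).trace := by
        rw [hU, Matrix.trace_mul_comm, Matrix.mul_assoc, hU]; simp

lemma mcomm_conj {n : ℕ} (U A B : Matrix (Fin n) (Fin n) ℝ) (hU : U * Uᵀ = 1) :
    mcomm (Uᵀ * A * U) (Uᵀ * B * U) = Uᵀ * mcomm A B * U := by
  have : ∀ A B : Matrix (Fin n) (Fin n) ℝ, (Uᵀ * A * U) * (Uᵀ * B * U) = Uᵀ * (A * B) * U := by
    intro A B
    calc _ = Uᵀ * A * (U * Uᵀ) * B * U := by simp only [Matrix.mul_assoc]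
      _ = _ := by rw [hU]; simp only [Matrix.mul_assoc, Matrix.one_mul]
  simp only [mcomm, this, Matrix.mul_sub, Matrix.sub_mul]

lemma dd_spectral {n : ℕ} (Q : Matrix (Fin n) (Fin n) ℝ) (hQ : Q.IsSymm) :
    ∃ (U : Matrix (Fin n) (Fin n) ℝ) (l : Fin n → ℝ),
      U * Uᵀ = 1 ∧ Uᵀ * Q * U = Matrix.diagonal l := by
  have hH : Q.IsHermitian := by
    rw [Matrix.IsHermitian, Matrix.conjTranspose_eq_transpose_of_trivial]; exact hQ
  refine ⟨hH.eigenvectorUnitary, hH.eigenvalues, ?_, ?_⟩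
  · have := (Matrix.mem_unitaryGroup_iff).1 hH.eigenvectorUnitary.2
    rwa [Matrix.star_eq_conjTranspose, Matrix.conjTranspose_eq_transpose_of_trivial] at this
  · have := hH.conjStarAlgAut_star_eigenvectorUnitary
    rw [Unitary.conjStarAlgAut_apply] at this
    simpa [Matrix.star_eq_conjTranspose, Matrix.conjTranspose_eq_transpose_of_trivial,
      Function.comp_def] using this

lemma dd_row {n : ℕ} {ι : Type*} [DecidableEq ι] (S : Finset ι)
    (X : ι → Matrix (Fin n) (Fin n) ℝ)
    (hX : ∀ s ∈ S, (X s).IsSymm)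
    (ho : ∀ s ∈ S, ∀ t ∈ S, fip (X s) (X t) = if s = t then 1 else 0)
    (Q : Matrix (Fin n) (Fin n) ℝ) (hQ : Q.IsSymm) (hQ1 : frobSq Q = 1) :
    ∑ s ∈ S, (frobSq (mcomm Q (X s)) - 1) ≤ 1 := by
  obtain ⟨U, l, hU, hD⟩ := dd_spectral Q hQ
  have hl : ∑ i, l i ^ 2 = 1 := by
    rw [← hQ1, frobSq_eq, ← fip_conj U Q Q hU, hD, fip]
    simp [Matrix.trace, sq]
  have h := dd_diag S (fun s => Uᵀ * X s * U)
    (fun s hs => by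
      simp only [Matrix.IsSymm, Matrix.transpose_mul, Matrix.transpose_transpose, (hX s hs).eq,
        Matrix.mul_assoc])
    (fun s hs t ht => by rw [fip_conj U _ _ hU]; exact ho s hs t ht) l hl
  refine le_trans (le_of_eq ?_) h
  refine Finset.sum_congr rfl fun s _ => ?_
  rw [← hD, mcomm_conj U _ _ hU, frobSq_eq, frobSq_eq, fip_conj U _ _ hU]

lemma mcomm_smul {n : ℕ} (c d : ℝ) (A B : Matrix (Fin n) (Fin n) ℝ) :
    mcomm (c • A) (d • B) = (c * d) • mcomm A B := by
  simp [mcomm, smul_sub, smul_smul, mul_comm]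

lemma frobSq_mcomm_comm {n : ℕ} (A B : Matrix (Fin n) (Fin n) ℝ) :
    frobSq (mcomm A B) = frobSq (mcomm B A) := by
  have : mcomm A B = (-1 : ℝ) • mcomm B A := by simp [mcomm]
  rw [this, frobSq_smul]; norm_num

lemma dd_orth {n m : ℕ} (C : Fin m → Matrix (Fin n) (Fin n) ℝ) (hC : ∀ r, (C r).IsSymm)
    (ho : ∀ r s, r ≠ s → fip (C r) (C s) = 0) :
    ∑ r, ∑ s, frobSq (mcomm (C r) (C s)) ≤ (∑ r, frobSq (C r)) ^ 2 := by
  set x : Fin m → ℝ := fun r => frobSq (C r) with hx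
  have hx0 : ∀ r, 0 ≤ x r := fun r => frobSq_nonneg _
  set Q : Fin m → Matrix (Fin n) (Fin n) ℝ := fun r => (Real.sqrt (x r))⁻¹ • C r with hQ
  have hCQ : ∀ r, C r = Real.sqrt (x r) • Q r := by
    intro r
    by_cases h : x r = 0
    · have := frobSq_zero_iff _ h
      simp [hQ, this]
    · have : Real.sqrt (x r) ≠ 0 := by
        rw [Real.sqrt_ne_zero (hx0 r)]; exact h
      simp [hQ, smul_smul, this]
  have hQs : ∀ r, (Q r).IsSymm := fun r => (hC r).smul _
  have hQ1 : ∀ r, x r ≠ 0 → frobSq (Q r) = 1 := by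
    intro r h
    simp only [hQ]
    rw [frobSq_smul, inv_pow, Real.sq_sqrt (hx0 r)]
    exact inv_mul_cancel₀ h
  set a : Fin m → Fin m → ℝ := fun r s => frobSq (mcomm (Q r) (Q s)) with ha
  have haC : ∀ r s, frobSq (mcomm (C r) (C s)) = x r * x s * a r s := by
    intro r s
    rw [hCQ r, hCQ s, mcomm_smul, frobSq_smul, mul_pow, Real.sq_sqrt (hx0 r),
      Real.sq_sqrt (hx0 s)]
  have hz : frobSq (0 : Matrix (Fin n) (Fin n) ℝ) = 0 := by simp [frobSq]
  have hsymm : ∀ r s, a r s = a s r := fun r s => frobSq_mcomm_comm _ _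
  have ha0 : ∀ r s, x r = 0 → a r s = 0 := by
    intro r s h
    have : Q r = 0 := by simp [hQ, h]
    simp [ha, this, mcomm, hz]
  have hdiag : ∀ r, a r r = 0 := by
    intro r; simp [ha, mcomm, hz]
  set c : Fin m → Fin m → ℝ := fun r s => max (a r s - 1) 0 with hc
  have hc0 : ∀ r s, 0 ≤ c r s := fun r s => le_max_right _ _
  have hcs : ∀ r s, c r s = c s r := fun r s => by simp only [hc]; rw [hsymm]
  have hrow : ∀ r, ∑ s, c r s ≤ 1 := by
    intro r
    by_cases h : x r = 0
    · have : ∀ s, c r s = 0 := fun s => by simp [hc, ha0 r s h]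
      simp [this]
    · have hne : ∀ s ∈ Finset.univ.filter (fun s => 1 < a r s), x s ≠ 0 := by
        intro s hs h0
        rw [Finset.mem_filter, hsymm, ha0 s r h0] at hs
        linarith [hs.2]
      refine le_trans (le_of_eq ?_) (dd_row (Finset.univ.filter fun s => 1 < a r s) Q
        (fun s _ => hQs s) ?_ (Q r) (hQs r) (hQ1 r h))
      · rw [Finset.sum_filter]
        refine Finset.sum_congr rfl fun s _ => ?_
        simp only [hc]
        split_ifs with h
        · exact max_eq_left (by linarith)
        · exact max_eq_right (by linarith)
      · intro s hs t ht
        split_ifs with e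
        · subst e; rw [← frobSq_eq]; exact hQ1 s (hne s hs)
        · simp only [hQ]; rw [fip_smul, ho s t e, mul_zero]
  have hterm : ∀ r s, x r * x s * a r s ≤ x r * x s + c r s * x r ^ 2 / 2 + c s r * x s ^ 2 / 2
      - (if r = s then x r ^ 2 else 0) := by
    intro r s
    rw [hcs s r]
    split_ifs with e
    · subst e
      rw [hdiag]
      nlinarith [mul_nonneg (hc0 r r) (sq_nonneg (x r))]
    · have h1 : a r s - 1 ≤ c r s := le_max_left _ _
      nlinarith [mul_le_mul_of_nonneg_left h1 (mul_nonneg (hx0 r) (hx0 s)),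
        mul_nonneg (hc0 r s) (sq_nonneg (x r - x s))]
  have hcx : ∑ r, ∑ s, c r s * x r ^ 2 / 2 ≤ (∑ r, x r ^ 2) / 2 := by
    rw [Finset.sum_div]
    refine Finset.sum_le_sum fun r _ => ?_
    rw [← Finset.sum_div, ← Finset.sum_mul]
    nlinarith [mul_le_mul_of_nonneg_right (hrow r) (sq_nonneg (x r))]
  have hcx' : ∑ r, ∑ s, c s r * x s ^ 2 / 2 ≤ (∑ r, x r ^ 2) / 2 := by
    rw [Finset.sum_comm]; exact hcx
  calc ∑ r, ∑ s, frobSq (mcomm (C r) (C s)) = ∑ r, ∑ s, x r * x s * a r s := by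
        simp only [haC]
    _ ≤ ∑ r, ∑ s, (x r * x s + c r s * x r ^ 2 / 2 + c s r * x s ^ 2 / 2
      - (if r = s then x r ^ 2 else 0)) :=
        Finset.sum_le_sum fun r _ => Finset.sum_le_sum fun s _ => hterm r s
    _ = (∑ r, x r) ^ 2 + ∑ r, ∑ s, c r s * x r ^ 2 / 2 + ∑ r, ∑ s, c s r * x s ^ 2 / 2
        - ∑ r, x r ^ 2 := by
        simp only [Finset.sum_sub_distrib, Finset.sum_add_distrib, Finset.sum_ite_eq,
          Finset.mem_univ, if_true, sq (∑ r, x r), Finset.sum_mul_sum]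
    _ ≤ (∑ r, x r) ^ 2 := by linarith

lemma dd_rot {m : ℕ} (O : Matrix (Fin m) (Fin m) ℝ) (hO : O * Oᵀ = 1) (v : Fin m → ℝ) :
    ∑ r, (∑ k, O k r * v k) ^ 2 = ∑ k, v k ^ 2 := by
  have h : (Oᵀ *ᵥ v) ⬝ᵥ (Oᵀ *ᵥ v) = v ⬝ᵥ v := by
    rw [Matrix.dotProduct_mulVec, Matrix.vecMul_transpose, Matrix.mulVec_mulVec, hO,
      Matrix.one_mulVec]
  simpa [dotProduct, Matrix.mulVec, sq] using h

lemma frob_rot {n m : ℕ} (O : Matrix (Fin m) (Fin m) ℝ) (hO : O * Oᵀ = 1)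
    (V : Fin m → Matrix (Fin n) (Fin n) ℝ) :
    ∑ r, frobSq (∑ k, O k r • V k) = ∑ k, frobSq (V k) := by
  simp only [frobSq]
  rw [Finset.sum_comm]
  conv_rhs => rw [Finset.sum_comm]
  refine Finset.sum_congr rfl fun i _ => ?_
  rw [Finset.sum_comm]
  conv_rhs => rw [Finset.sum_comm]
  refine Finset.sum_congr rfl fun j _ => ?_
  simp only [Matrix.sum_apply, Matrix.smul_apply, smul_eq_mul]
  exact dd_rot O hO fun k => V k i j

lemma mcomm_sum_left {n m : ℕ} (w : Fin m → ℝ) (V : Fin m → Matrix (Fin n) (Fin n) ℝ)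
    (A : Matrix (Fin n) (Fin n) ℝ) :
    mcomm (∑ k, w k • V k) A = ∑ k, w k • mcomm (V k) A := by
  simp [mcomm, Matrix.sum_mul, Matrix.mul_sum, smul_sub]

lemma mcomm_sum_right {n m : ℕ} (w : Fin m → ℝ) (V : Fin m → Matrix (Fin n) (Fin n) ℝ)
    (A : Matrix (Fin n) (Fin n) ℝ) :
    mcomm A (∑ k, w k • V k) = ∑ k, w k • mcomm A (V k) := by
  simp [mcomm, Matrix.sum_mul, Matrix.mul_sum, smul_sub]

/-- The DDVV inequality (Conjecture 1): for real symmetric matrices `B₁, …, B_m`,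
`∑_{r,s} ‖[B_r, B_s]‖² ≤ (∑_r ‖B_r‖²)²`. -/
theorem ddvv_inequality (n m : ℕ) (hn : 1 ≤ n) (hm : 1 ≤ m)
    (B : Fin m → Matrix (Fin n) (Fin n) ℝ) (hsymm : ∀ r, (B r).IsSymm) :
    ∑ r, ∑ s, frobSq (mcomm (B r) (B s)) ≤ (∑ r, frobSq (B r)) ^ 2 := by
  obtain ⟨O, l, hO, hD⟩ := dd_spectral (Matrix.of fun r s => fip (B r) (B s))
    (by
      ext r s
      simp only [Matrix.transpose_apply, Matrix.of_apply, fip_eq, mul_comm])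
  set C : Fin m → Matrix (Fin n) (Fin n) ℝ := fun r => ∑ k, O k r • B k with hC
  have h1 : ∑ r, frobSq (B r) = ∑ r, frobSq (C r) := (frob_rot O hO B).symm
  have h2 : ∑ r, ∑ s, frobSq (mcomm (C r) (C s)) = ∑ r, ∑ s, frobSq (mcomm (B r) (B s)) := by
    calc _ = ∑ r, ∑ s, frobSq (mcomm (C r) (B s)) := by
          refine Finset.sum_congr rfl fun r _ => ?_
          rw [← frob_rot O hO fun s => mcomm (C r) (B s)]
          refine Finset.sum_congr rfl fun s _ => ?_
          rw [← mcomm_sum_right]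
      _ = ∑ s, ∑ r, frobSq (mcomm (C r) (B s)) := Finset.sum_comm
      _ = ∑ s, ∑ r, frobSq (mcomm (B r) (B s)) := by
          refine Finset.sum_congr rfl fun s _ => ?_
          rw [← frob_rot O hO fun r => mcomm (B r) (B s)]
          refine Finset.sum_congr rfl fun r _ => ?_
          rw [← mcomm_sum_left]
      _ = _ := Finset.sum_comm
  rw [h1, ← h2]
  refine dd_orth C ?_ ?_
  · intro r
    simp only [hC, Matrix.IsSymm, Matrix.transpose_sum, Matrix.transpose_smul, (hsymm _).eq]
  · intro r s hrs
    have h := congrFun (congrFun hD r) s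
    rw [Matrix.diagonal_apply_ne _ hrs] at h
    rw [← h]
    simp only [hC, fip, Matrix.transpose_sum, Matrix.sum_mul, Matrix.mul_sum, Matrix.trace_sum,
      Matrix.mul_apply, Matrix.of_apply, Matrix.transpose_apply, Finset.sum_mul,
      Matrix.transpose_smul, Matrix.smul_mul, Matrix.mul_smul, Matrix.trace_smul, smul_eq_mul]
    rw [Finset.sum_comm]
    refine Finset.sum_congr rfl fun k _ => Finset.sum_congr rfl fun k' _ => ?_
    ring
end

section
/- Let n ≥ 1 and N = n(n+1)/2. For any orthonormal basis {Q̂_α}_{α=1}^N of SM(n) and any nonnegative real numbers x_1, ..., x_N, Σ_{α,β=1}^N x_α x_β ‖[Q̂_α, Q̂_β]‖² ≤ (Σ_{α=1}^N x_α)². -/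
open Matrix BigOperators

/-- the four-point consequence of `∑ l² = 1` -/
lemma aux_disj {n : ℕ} (l : Fin n → ℝ) (hl : ∑ i, l i ^ 2 = 1) (p q r s : Fin n)
    (hpr : p ≠ r) (hps : p ≠ s) (hqr : q ≠ r) (hqs : q ≠ s)
    (h1 : 1 < (l p - l q) ^ 2) (h2 : 1 < (l r - l s) ^ 2) : False := by
  have hpq : p ≠ q := by rintro rfl; norm_num at h1
  have hrs : r ≠ s := by rintro rfl; norm_num at h2
  have h : ∑ i ∈ ({p, q, r, s} : Finset (Fin n)), l i ^ 2 ≤ ∑ i, l i ^ 2 :=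
    Finset.sum_le_sum_of_subset_of_nonneg (Finset.subset_univ _) (fun _ _ _ => sq_nonneg _)
  rw [Finset.sum_insert (by simp [*]), Finset.sum_insert (by simp [*]),
    Finset.sum_insert (by simp [*]), Finset.sum_singleton, hl] at h
  nlinarith [sq_nonneg (l p + l q), sq_nonneg (l r + l s)]

lemma aux_two {n : ℕ} (l : Fin n → ℝ) (hl : ∑ i, l i ^ 2 = 1) (p q : Fin n) :
    (l p - l q) ^ 2 ≤ 2 := by
  by_cases hpq : p = q
  · subst hpq; norm_num
  have h : ∑ i ∈ ({p, q} : Finset (Fin n)), l i ^ 2 ≤ ∑ i, l i ^ 2 :=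
    Finset.sum_le_sum_of_subset_of_nonneg (Finset.subset_univ _) (fun _ _ _ => sq_nonneg _)
  rw [Finset.sum_pair hpq, hl] at h
  nlinarith [sq_nonneg (l p + l q)]

lemma aux_tri (a b c : ℝ) (h1 : 1 < (a - b) ^ 2) (h2 : 1 < (b - c) ^ 2) (h3 : 1 < (a - c) ^ 2)
    (k1 : (a - b) ^ 2 ≤ 2) (k2 : (b - c) ^ 2 ≤ 2) (k3 : (a - c) ^ 2 ≤ 2) : False := by
  rw [one_lt_sq_iff_one_lt_abs, lt_abs] at h1 h2 h3
  rcases h1 with h1 | h1 <;> rcases h2 with h2 | h2 <;> rcases h3 with h3 | h3 <;> nlinarith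

lemma aux_center {n : ℕ} (hn : 1 ≤ n) (l : Fin n → ℝ) (hl : ∑ i, l i ^ 2 = 1) :
    ∃ a, ∀ i j, 1 < (l i - l j) ^ 2 → i = a ∨ j = a := by
  by_contra! hcon
  have hsw : ∀ i j, 1 < (l i - l j) ^ 2 → 1 < (l j - l i) ^ 2 := by
    intro i j h; nlinarith
  obtain ⟨p, q, hpq, -, -⟩ := hcon ⟨0, hn⟩
  -- an edge q r avoiding p
  have h1 : ∃ r, 1 < (l q - l r) ^ 2 ∧ r ≠ p := by
    obtain ⟨i, j, hij, hi, hj⟩ := hcon p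
    by_cases e1 : i = q
    · subst e1; exact ⟨j, hij, hj⟩
    by_cases e2 : j = q
    · subst e2; exact ⟨i, hsw _ _ hij, hi⟩
    exact (aux_disj l hl p q i j (Ne.symm hi) (Ne.symm hj) (Ne.symm e1) (Ne.symm e2) hpq hij).elim
  have h2 : ∃ s, 1 < (l p - l s) ^ 2 ∧ s ≠ q := by
    obtain ⟨i, j, hij, hi, hj⟩ := hcon q
    by_cases e1 : i = p
    · subst e1; exact ⟨j, hij, hj⟩
    by_cases e2 : j = p
    · subst e2; exact ⟨i, hsw _ _ hij, hi⟩
    exact (aux_disj l hl p q i j (Ne.symm e1) (Ne.symm e2) (Ne.symm hi) (Ne.symm hj) hpq hij).elim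
  obtain ⟨r, hr, hrp⟩ := h1
  obtain ⟨s, hs, hsq⟩ := h2
  by_cases hrs : r = s
  · subst hrs
    exact aux_tri (l p) (l q) (l r) hpq hr hs (aux_two l hl _ _) (aux_two l hl _ _)
      (aux_two l hl _ _)
  · have : q ≠ p := by rintro rfl; norm_num at hpq
    exact aux_disj l hl q r p s this (Ne.symm hsq) hrp hrs hr hs

lemma aux_star {n : ℕ} (l : Fin n → ℝ) (hl : ∑ i, l i ^ 2 = 1) (a : Fin n)
    (J : Finset (Fin n)) (ha : a ∉ J) : ∑ j ∈ J, ((l a - l j) ^ 2 - 1) ≤ 1 := by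
  have h : ∑ i ∈ insert a J, l i ^ 2 ≤ ∑ i, l i ^ 2 :=
    Finset.sum_le_sum_of_subset_of_nonneg (Finset.subset_univ _) (fun _ _ _ => sq_nonneg _)
  rw [Finset.sum_insert ha, hl] at h
  have hcs := sq_sum_le_card_mul_sum_sq (s := J) (f := l)
  have e : ∑ j ∈ J, ((l a - l j) ^ 2 - 1)
      = J.card * l a ^ 2 - 2 * l a * ∑ j ∈ J, l j + ∑ j ∈ J, l j ^ 2 - J.card := by
    simp only [sub_sq, Finset.sum_sub_distrib, Finset.sum_add_distrib, Finset.mul_sum,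
      Finset.sum_const, nsmul_eq_mul, mul_one]
  rw [e]
  have hk : (0 : ℝ) ≤ J.card := by positivity
  nlinarith [sq_nonneg (l a + ∑ j ∈ J, l j), mul_le_mul_of_nonneg_left h hk]

lemma aux_eig {n : ℕ} (hn : 1 ≤ n) (l : Fin n → ℝ) (hl : ∑ i, l i ^ 2 = 1) :
    ∑ i, ∑ j, max ((l i - l j) ^ 2 - 1) 0 ≤ 2 := by
  obtain ⟨a, ha⟩ := aux_center hn l hl
  have hstar : ∑ j, max ((l a - l j) ^ 2 - 1) 0 ≤ 1 := by
    have := aux_star l hl a (Finset.univ.filter fun j => 1 < (l a - l j) ^ 2) (by simp)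
    rw [Finset.sum_filter] at this
    refine le_trans (Finset.sum_le_sum fun j _ => ?_) this
    split_ifs with h
    · exact max_le le_rfl (by linarith)
    · exact max_le (by linarith) le_rfl
  have key : ∀ i j, max ((l i - l j) ^ 2 - 1) 0 ≤
      (if i = a then max ((l a - l j) ^ 2 - 1) 0 else 0) +
      (if j = a then max ((l a - l i) ^ 2 - 1) 0 else 0) := by
    intro i j
    have n1 : (0 : ℝ) ≤ (if i = a then max ((l a - l j) ^ 2 - 1) 0 else 0) := by
      split_ifs <;> simp
    have n2 : (0 : ℝ) ≤ (if j = a then max ((l a - l i) ^ 2 - 1) 0 else 0) := by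
      split_ifs <;> simp
    by_cases h : 1 < (l i - l j) ^ 2
    · rcases ha i j h with rfl | rfl
      · rw [if_pos rfl]; linarith
      · rw [if_pos rfl, sub_sq_comm (l i)]; linarith
    · exact max_le (by linarith) (by linarith)
  calc _ ≤ ∑ i, ∑ j, ((if i = a then max ((l a - l j) ^ 2 - 1) 0 else 0) +
      (if j = a then max ((l a - l i) ^ 2 - 1) 0 else 0)) :=
        Finset.sum_le_sum fun i _ => Finset.sum_le_sum fun j _ => key i j
    _ = ∑ j, max ((l a - l j) ^ 2 - 1) 0 + ∑ j, max ((l a - l j) ^ 2 - 1) 0 := by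
        simp only [Finset.sum_add_distrib]
        congr 1
        · rw [Finset.sum_comm]; simp
        · simp
    _ ≤ 2 := by linarith

lemma aux_trace {n : ℕ} (A B : Matrix (Fin n) (Fin n) ℝ) :
    ∑ i, ∑ j, A i j * B i j = (A * Bᵀ).trace := by
  simp [Matrix.trace, Matrix.mul_apply]

lemma aux_conj {n : ℕ} (U A B : Matrix (Fin n) (Fin n) ℝ) (hU : U * Uᵀ = 1) :
    ∑ i, ∑ j, (Uᵀ * A * U) i j * (Uᵀ * B * U) i j = ∑ i, ∑ j, A i j * B i j := by
  rw [aux_trace, aux_trace]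
  have : (Uᵀ * A * U) * (Uᵀ * B * U)ᵀ = Uᵀ * (A * Bᵀ * U) := by
    simp only [Matrix.transpose_mul, Matrix.transpose_transpose]
    calc _ = Uᵀ * A * (U * Uᵀ) * (Bᵀ * U) := by simp only [Matrix.mul_assoc]
      _ = _ := by rw [hU]; simp only [Matrix.mul_assoc, Matrix.mul_one]
  rw [this, Matrix.trace_mul_comm, Matrix.mul_assoc, hU, Matrix.mul_one]

/-- Bessel's inequality on an off-diagonal entry. -/
lemma aux_bessel {n : ℕ} {ι : Type*} [DecidableEq ι] (S : Finset ι)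
    (B : ι → Matrix (Fin n) (Fin n) ℝ) (hs : ∀ b, (B b).IsSymm)
    (ho : ∀ a b, (∑ i, ∑ j, B a i j * B b i j) = if a = b then 1 else 0)
    (i j : Fin n) (hij : i ≠ j) : ∑ b ∈ S, (B b i j) ^ 2 ≤ 1 / 2 := by
  let v : ι → EuclideanSpace ℝ (Fin n × Fin n) := fun b => WithLp.toLp 2 fun p => B b p.1 p.2
  have hv : Orthonormal ℝ v := by
    rw [orthonormal_iff_ite]
    intro a b
    rw [← ho a b]
    simp [v, PiLp.inner_apply, Fintype.sum_prod_type, mul_comm]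
  let E : EuclideanSpace ℝ (Fin n × Fin n) :=
    EuclideanSpace.single (i, j) 1 + EuclideanSpace.single (j, i) 1
  have hb := hv.sum_inner_products_le (x := E) (s := S)
  have h1 : ∀ b, inner ℝ (v b) E = 2 * B b i j := by
    intro b
    have := (hs b).apply i j
    simp only [E, inner_add_right, EuclideanSpace.inner_single_right, v]
    simp
    linarith
  have h2 : ‖E‖ ^ 2 = 2 := by
    rw [← real_inner_self_eq_norm_sq]
    simp only [E, inner_add_right, inner_add_left, EuclideanSpace.inner_single_right]
    simp [hij, hij.symm]
    norm_num
  simp only [h1, h2] at hb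
  have h3 : ∑ b ∈ S, ‖2 * B b i j‖ ^ 2 = 4 * ∑ b ∈ S, (B b i j) ^ 2 := by
    rw [Finset.mul_sum]
    refine Finset.sum_congr rfl fun b _ => ?_
    rw [Real.norm_eq_abs, sq_abs]; ring
  linarith

lemma aux_row {n : ℕ} (hn : 1 ≤ n) {ι : Type*} [DecidableEq ι] (S : Finset ι)
    (B : ι → Matrix (Fin n) (Fin n) ℝ) (hs : ∀ b, (B b).IsSymm)
    (ho : ∀ a b, (∑ i, ∑ j, B a i j * B b i j) = if a = b then 1 else 0)
    (a : ι) : ∑ b ∈ S, frobSq (mcomm (B a) (B b)) ≤ S.card + 1 := by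
  have hA : (B a).IsHermitian := by
    rw [Matrix.IsHermitian, Matrix.conjTranspose_eq_transpose_of_trivial]; exact hs a
  obtain ⟨U, l, hU, hU', hD⟩ : ∃ (U : Matrix (Fin n) (Fin n) ℝ) (l : Fin n → ℝ),
      U * Uᵀ = 1 ∧ Uᵀ * U = 1 ∧ Uᵀ * B a * U = Matrix.diagonal l := by
    have h1 : (hA.eigenvectorUnitary : Matrix (Fin n) (Fin n) ℝ) *
        (hA.eigenvectorUnitary : Matrix (Fin n) (Fin n) ℝ)ᵀ = 1 := by
      have := Unitary.coe_mul_star_self hA.eigenvectorUnitary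
      simpa [Matrix.star_eq_conjTranspose, Matrix.conjTranspose_eq_transpose_of_trivial] using this
    have h2 := mul_eq_one_comm.mp h1
    refine ⟨hA.eigenvectorUnitary, hA.eigenvalues, h1, h2, ?_⟩
    have := hA.spectral_theorem
    rw [Unitary.conjStarAlgAut_apply, Matrix.star_eq_conjTranspose,
      Matrix.conjTranspose_eq_transpose_of_trivial] at this
    generalize (hA.eigenvectorUnitary : Matrix (Fin n) (Fin n) ℝ) = V at *
    have e : B a = V * Matrix.diagonal hA.eigenvalues * Vᵀ := this
    generalize hA.eigenvalues = l at *
    calc Vᵀ * B a * V = Vᵀ * (V * Matrix.diagonal l * Vᵀ) * V := by rw [← e]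
      _ = (Vᵀ * V) * Matrix.diagonal l * (Vᵀ * V) := by simp only [Matrix.mul_assoc]
      _ = _ := by rw [h2]; simp
  let C : ι → Matrix (Fin n) (Fin n) ℝ := fun b => Uᵀ * B b * U
  have hCs : ∀ b, (C b).IsSymm := by
    intro b
    simp only [C, Matrix.IsSymm, Matrix.transpose_mul, Matrix.transpose_transpose, (hs b).eq,
      Matrix.mul_assoc]
  have hCo : ∀ a b, (∑ i, ∑ j, C a i j * C b i j) = if a = b then 1 else 0 := by
    intro a b
    rw [← ho a b]; exact aux_conj U _ _ hU
  have hl : ∑ i, l i ^ 2 = 1 := by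
    have := hCo a a
    simp only [C, hD, if_true, Matrix.diagonal_apply] at this
    simpa [pow_two] using this
  have hfrob : ∀ b, frobSq (mcomm (B a) (B b)) = ∑ i, ∑ j, (l i - l j) ^ 2 * (C b i j) ^ 2 := by
    intro b
    have e : Uᵀ * mcomm (B a) (B b) * U = Matrix.diagonal l * C b - C b * Matrix.diagonal l := by
      rw [← hD]
      simp only [C, mcomm, Matrix.mul_sub, Matrix.sub_mul]
      congr 1
      · calc _ = Uᵀ * B a * 1 * B b * U := by simp only [Matrix.mul_assoc, Matrix.one_mul]
          _ = _ := by rw [← hU]; simp only [Matrix.mul_assoc]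
      · calc _ = Uᵀ * B b * 1 * B a * U := by simp only [Matrix.mul_assoc, Matrix.one_mul]
          _ = _ := by rw [← hU]; simp only [Matrix.mul_assoc]
    have h := aux_conj U (mcomm (B a) (B b)) (mcomm (B a) (B b)) hU
    rw [e] at h
    simp only [frobSq, pow_two] at *
    rw [← h]
    refine Finset.sum_congr rfl fun i _ => Finset.sum_congr rfl fun j _ => ?_
    simp only [Matrix.sub_apply, Matrix.diagonal_mul, Matrix.mul_diagonal]
    ring
  have hb : ∀ b, frobSq (mcomm (B a) (B b)) ≤
      1 + ∑ i, ∑ j, max ((l i - l j) ^ 2 - 1) 0 * (C b i j) ^ 2 := by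
    intro b
    have h1 := hCo b b
    rw [if_pos rfl] at h1
    suffices h : ∑ i, ∑ j, (l i - l j) ^ 2 * (C b i j) ^ 2 ≤ ∑ i, ∑ j, C b i j * C b i j +
        ∑ i, ∑ j, max ((l i - l j) ^ 2 - 1) 0 * (C b i j) ^ 2 by
      rw [hfrob]; rwa [h1] at h
    rw [← Finset.sum_add_distrib]
    refine Finset.sum_le_sum fun i _ => ?_
    rw [← Finset.sum_add_distrib]
    refine Finset.sum_le_sum fun j _ => ?_
    nlinarith [le_max_left ((l i - l j) ^ 2 - 1) 0, sq_nonneg (C b i j)]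
  calc _ ≤ ∑ b ∈ S, (1 + ∑ i, ∑ j, max ((l i - l j) ^ 2 - 1) 0 * (C b i j) ^ 2) :=
        Finset.sum_le_sum fun b _ => hb b
    _ = S.card + ∑ i, ∑ j, max ((l i - l j) ^ 2 - 1) 0 * ∑ b ∈ S, (C b i j) ^ 2 := by
        rw [Finset.sum_add_distrib, Finset.sum_comm]
        congr 1
        · simp
        · refine Finset.sum_congr rfl fun i _ => ?_
          rw [Finset.sum_comm]
          simp only [Finset.mul_sum]
    _ ≤ S.card + ∑ i, ∑ j, max ((l i - l j) ^ 2 - 1) 0 * (1 / 2) := by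
        refine add_le_add le_rfl (Finset.sum_le_sum fun i _ => Finset.sum_le_sum fun j _ => ?_)
        by_cases hij : i = j
        · subst hij; simp
        · exact mul_le_mul_of_nonneg_left (aux_bessel S C hCs hCo i j hij) (le_max_right _ _)
    _ ≤ S.card + 1 := by
        have := aux_eig hn l hl
        simp only [← Finset.sum_mul]
        linarith

/-- Layer-cake argument. -/
lemma aux_layer {ι : Type*} [DecidableEq ι] (c : ι → ι → ℝ)
    (hsym : ∀ a b, c a b = c b a)
    (hrow : ∀ (S : Finset ι) (a : ι), a ∈ S → ∑ b ∈ S, c a b ≤ S.card) :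
    ∀ (k : ℕ) (S : Finset ι) (x : ι → ℝ), S.card = k → (∀ a ∈ S, 0 ≤ x a) →
      ∑ a ∈ S, ∑ b ∈ S, x a * x b * c a b ≤ (∑ a ∈ S, x a) ^ 2 := by
  intro k
  induction k with
  | zero =>
    intro S x hS _
    rw [Finset.card_eq_zero] at hS
    simp [hS]
  | succ k ih =>
    intro S x hS hx
    have hne : S.Nonempty := by rw [← Finset.card_pos]; omega
    obtain ⟨s, hs, hmin⟩ := Finset.exists_min_image S x hne
    have ih' := ih (S.erase s) (fun a => x a - x s) (by rw [Finset.card_erase_of_mem hs]; omega)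
      (fun a ha => by have := hmin a (Finset.mem_of_mem_erase ha); linarith)
    have e1 : ∑ a ∈ S.erase s, ∑ b ∈ S.erase s, (x a - x s) * (x b - x s) * c a b
        = ∑ a ∈ S, ∑ b ∈ S, (x a - x s) * (x b - x s) * c a b := by
      rw [← Finset.sum_erase S (a := s) (by simp)]
      refine Finset.sum_congr rfl fun a _ => ?_
      rw [Finset.sum_erase S (by simp)]
    have e2 : ∑ a ∈ S.erase s, (x a - x s) = ∑ a ∈ S, (x a - x s) :=
      Finset.sum_erase S (by simp)
    rw [e1, e2] at ih'
    have hm : 0 ≤ x s := hx s hs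
    have f1 : ∑ a ∈ S, ∑ b ∈ S, x a * x b * c a b
        = ∑ a ∈ S, ∑ b ∈ S, (x a - x s) * (x b - x s) * c a b
          + 2 * x s * ∑ a ∈ S, (x a - x s) * ∑ b ∈ S, c a b
          + x s ^ 2 * ∑ a ∈ S, ∑ b ∈ S, c a b := by
      have sw : ∑ a ∈ S, ∑ b ∈ S, (x b - x s) * c a b
          = ∑ a ∈ S, ∑ b ∈ S, (x a - x s) * c a b := by
        rw [Finset.sum_comm]
        refine Finset.sum_congr rfl fun a _ => Finset.sum_congr rfl fun b _ => ?_
        rw [hsym]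
      have : ∑ a ∈ S, ∑ b ∈ S, x a * x b * c a b
        = ∑ a ∈ S, ∑ b ∈ S, (x a - x s) * (x b - x s) * c a b
          + x s * ∑ a ∈ S, ∑ b ∈ S, (x a - x s) * c a b
          + x s * ∑ a ∈ S, ∑ b ∈ S, (x b - x s) * c a b
          + x s ^ 2 * ∑ a ∈ S, ∑ b ∈ S, c a b := by
        simp only [Finset.mul_sum, ← Finset.sum_add_distrib]
        refine Finset.sum_congr rfl fun a _ => Finset.sum_congr rfl fun b _ => ?_
        ring
      rw [this, sw]
      simp only [← Finset.mul_sum]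
      ring
    have g1 : ∑ a ∈ S, (x a - x s) * ∑ b ∈ S, c a b ≤ (∑ a ∈ S, (x a - x s)) * S.card := by
      rw [Finset.sum_mul]
      exact Finset.sum_le_sum fun a ha =>
        mul_le_mul_of_nonneg_left (hrow S a ha) (by have := hmin a ha; linarith)
    have g2 : ∑ a ∈ S, ∑ b ∈ S, c a b ≤ (S.card : ℝ) * S.card := by
      calc _ ≤ ∑ a ∈ S, (S.card : ℝ) := Finset.sum_le_sum fun a ha => hrow S a ha
        _ = _ := by simp
    have f2 : ∑ a ∈ S, x a = ∑ a ∈ S, (x a - x s) + S.card * x s := by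
      simp [Finset.sum_sub_distrib]
    rw [f1, f2]
    nlinarith [mul_le_mul_of_nonneg_left g1 hm, mul_le_mul_of_nonneg_left g2 (sq_nonneg (x s))]

/-- Inequality (3.2): for any orthonormal basis `{Q̂_α}` of the space of `n×n` real
symmetric matrices (`N = n(n+1)/2`) and nonnegative reals `x_1, …, x_N`,
`∑_{α,β} x_α x_β ‖[Q̂_α, Q̂_β]‖² ≤ (∑_α x_α)²`. -/
theorem quadratic_commutator_bound (n N : ℕ) (hn : 1 ≤ n) (hN : N = n * (n + 1) / 2)
    (Q : Fin N → Matrix (Fin n) (Fin n) ℝ) (hsymm : ∀ α, (Q α).IsSymm)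
    (horth : ∀ α β, (∑ i, ∑ j, Q α i j * Q β i j) = if α = β then 1 else 0)
    (x : Fin N → ℝ) (hx : ∀ α, 0 ≤ x α) :
    ∑ α, ∑ β, x α * x β * frobSq (mcomm (Q α) (Q β)) ≤ (∑ α, x α) ^ 2 := by
  refine aux_layer (fun a b => frobSq (mcomm (Q a) (Q b))) ?_ ?_ _ Finset.univ x rfl
    (fun a _ => hx a)
  · intro a b
    simp only [frobSq, mcomm, Matrix.sub_apply]
    refine Finset.sum_congr rfl fun i _ => Finset.sum_congr rfl fun j _ => ?_
    ring
  · intro S a ha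
    have h := aux_row hn (S.erase a) Q hsymm horth a
    rw [Finset.sum_erase S (by simp [frobSq, mcomm])] at h
    have hc : ((S.erase a).card : ℝ) + 1 = S.card := by
      exact_mod_cast Finset.card_erase_add_one ha
    linarith
end
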